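/- Consider the inverse-problem setting with exact coefficient c satisfying c(x) ≥ 0 on Ω, exact solution u, and f satisfying condition (7). Let c⁰ be the initial approximation defined by (16) and u⁰ the sufficiently smooth solution of the direct problem with coefficient c⁰. Then c⁰(x) ≥ c(x) for all x ∈ Ω, and u⁰(x,t) ≤ u(x,t) for all x ∈ Ω, 0 < t ≤ T. -/

import Mathlib

noncomputable section

/-- The plane `ℝ²`. -/
abbrev E2 : Type := EuclideanSpace ℝ (Fin 2)

/-- The elliptic operator `(A v)(x) = - div (k(x) grad v(x))`. -/
def ellOp (k : E2 → ℝ) (v : E2 → ℝ) (x : E2) : ℝ :=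
  - ∑ i : Fin 2, fderiv ℝ (fun y => k y • gradient v y) x (EuclideanSpace.single i 1) i

/-- `u` solves the direct problem on `Ω × (0,T]` with diffusion coefficient `k`,
Robin boundary coefficient `μ`, reaction coefficient `c` and right-hand side `f`:
the parabolic equation, the homogeneous initial condition and the homogeneous
Robin (third-kind) boundary condition with respect to any outward unit normal. -/
structure IsDirectSolution (Ω : Set E2) (T : ℝ) (k μ : E2 → ℝ)
    (c : E2 → ℝ) (f : E2 → ℝ → ℝ) (u : E2 → ℝ → ℝ) : Prop where
  pde : ∀ x ∈ Ω, ∀ t : ℝ, 0 < t → t ≤ T →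
    deriv (u x) t + ellOp k (fun y => u y t) x + c x * u x t = f x t
  ic : ∀ x ∈ Ω, u x 0 = 0
  robin : ∀ x ∈ frontier Ω, ∀ ν : E2, ‖ν‖ = 1 →
    (∀ y ∈ closure Ω, (inner ℝ ν (y - x) : ℝ) ≤ 0) →
    ∀ t : ℝ, 0 < t → t ≤ T →
      k x * fderiv ℝ (fun y => u y t) x ν + μ x * u x t = 0

open Set Filter Topology

lemma grad_diff {v : E2 → ℝ} (hv : ContDiff ℝ 2 v) : Differentiable ℝ (gradient v) := by
  have h1 : ContDiff ℝ 1 (fderiv ℝ v) := hv.fderiv_right (by norm_num)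
  have h2 := h1.differentiable (by norm_num)
  exact (InnerProductSpace.toDual ℝ E2).symm.toContinuousLinearEquiv.differentiable.comp h2

lemma ellOp_formula {k v : E2 → ℝ} {x : E2} (hk : DifferentiableAt ℝ k x)
    (hv : ContDiff ℝ 2 v) :
    ellOp k v x = - ∑ i : Fin 2, (k x * (fderiv ℝ (gradient v) x (EuclideanSpace.single i 1)) i
      + fderiv ℝ k x (EuclideanSpace.single i 1) * gradient v x i) := by
  unfold ellOp
  rw [fderiv_fun_smul hk (grad_diff hv x)]
  simp

lemma grad_comb {v w : E2 → ℝ} (a : ℝ) (hv : ContDiff ℝ 2 v) (hw : ContDiff ℝ 2 w) :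
    gradient (fun y => v y + a * w y) = fun y => gradient v y + a • gradient w y := by
  funext y
  have h1 := (hv.differentiable (by norm_num) y)
  have h2 := (hw.differentiable (by norm_num) y)
  unfold gradient
  rw [fderiv_fun_add h1 (h2.const_mul a), fderiv_const_mul h2]
  simp

lemma ellOp_comb {k v w : E2 → ℝ} {x : E2} (a : ℝ) (hk : DifferentiableAt ℝ k x)
    (hv : ContDiff ℝ 2 v) (hw : ContDiff ℝ 2 w) :
    ellOp k (fun y => v y + a * w y) x = ellOp k v x + a * ellOp k w x := by
  rw [ellOp_formula hk hv, ellOp_formula hk hw, ellOp_formula hk (hv.add (contDiff_const.mul hw)),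
    grad_comb a hv hw]
  have h : fderiv ℝ (fun y => gradient v y + a • gradient w y) x
      = fderiv ℝ (gradient v) x + a • fderiv ℝ (gradient w) x :=
    ((grad_diff hv x).hasFDerivAt.add ((grad_diff hw x).hasFDerivAt.const_smul a)).fderiv
  rw [h]
  simp
  ring

lemma second_nonneg {v : E2 → ℝ} {x : E2} (hv : ContDiff ℝ 2 v) (hm : IsLocalMin v x) (i : Fin 2) :
    0 ≤ (fderiv ℝ (gradient v) x (EuclideanSpace.single i 1)) i := by
  set e : E2 := EuclideanSpace.single i 1 with he
  by_contra hneg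
  push Not at hneg
  set D := (fderiv ℝ (gradient v) x e) i with hD
  have hline : ∀ s : ℝ, HasDerivAt (fun s : ℝ => x + s • e) e s := fun s => by
    simpa using ((hasDerivAt_id s).smul_const e).const_add x
  have hg : ∀ s : ℝ, HasDerivAt (fun s : ℝ => v (x + s • e)) ((gradient v (x + s • e)) i) s := by
    intro s
    have h1 := (hv.differentiable (by norm_num) (x + s • e)).hasFDerivAt.comp_hasDerivAt s (hline s)
    have h2 : fderiv ℝ v (x + s • e) e = (gradient v (x + s • e)) i := by
      rw [← inner_gradient_left, he, EuclideanSpace.inner_single_right]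
      simp
    rw [← h2]; exact h1
  have hg2 : HasDerivAt (fun s : ℝ => (gradient v (x + s • e)) i) D 0 := by
    have h0 : HasFDerivAt (gradient v) (fderiv ℝ (gradient v) x) (x + (0:ℝ) • e) := by
      simpa using (grad_diff hv x).hasFDerivAt
    have h1 := h0.comp_hasDerivAt (0:ℝ) (hline 0)
    exact ((EuclideanSpace.proj i : E2 →L[ℝ] ℝ).hasFDerivAt.comp_hasDerivAt (0:ℝ) h1)
  have hgm : IsLocalMin (fun s : ℝ => v (x + s • e)) 0 := by
    have hc : Tendsto (fun s : ℝ => x + s • e) (𝓝 0) (𝓝 x) := by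
      have := (hline 0).continuousAt.tendsto
      simpa using this
    have := hc.eventually hm
    filter_upwards [this] with s hs
    simpa using hs
  have hG : ∀ s : ℝ, HasDerivAt (fun s : ℝ => v (x + s • e) + (-D/4) * s^2)
      ((gradient v (x + s • e)) i + (-D/4) * (2 * s)) s := by
    intro s
    have h3 : HasDerivAt (fun s : ℝ => s^2) (2 * s) s := by simpa using hasDerivAt_pow 2 s
    exact (hg s).add (h3.const_mul _)
  have hdG := funext fun s => (hG s).deriv
  have hmax : IsLocalMax (fun s : ℝ => v (x + s • e) + (-D/4) * s^2) 0 := by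
    apply isLocalMax_of_deriv_deriv_neg
    · rw [hdG]
      have h4 : HasDerivAt (fun s : ℝ => (gradient v (x + s • e)) i + (-D/4) * (2 * s))
        (D + (-D/4) * (2 * 1)) 0 := hg2.add (((hasDerivAt_id (0:ℝ)).const_mul 2).const_mul _)
      rw [h4.deriv]; linarith
    · rw [hdG]
      have := hgm.hasDerivAt_eq_zero (hg 0)
      simp only [this]; ring
    · exact (hG 0).continuousAt
  have h5 : ∀ᶠ s : ℝ in 𝓝[≠] 0, False := by
    filter_upwards [nhdsWithin_le_nhds hmax, nhdsWithin_le_nhds hgm, self_mem_nhdsWithin] with s a b hs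
    have a : v (x + s • e) + (-D/4) * s^2 ≤ v (x + (0:ℝ) • e) + (-D/4) * (0:ℝ)^2 := a
    have b : v (x + (0:ℝ) • e) ≤ v (x + s • e) := b
    have : 0 < s^2 := by have : s ≠ 0 := hs; positivity
    nlinarith
  exact h5.exists.elim fun _ h => h

lemma ellOp_min {k v : E2 → ℝ} {x : E2} (hk : DifferentiableAt ℝ k x) (hk0 : 0 ≤ k x)
    (hv : ContDiff ℝ 2 v) (hm : IsLocalMin v x) : ellOp k v x ≤ 0 := by
  rw [ellOp_formula hk hv]
  have h0 : gradient v x = 0 := by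
    unfold gradient; rw [hm.fderiv_eq_zero]; simp
  simp only [h0]
  simp only [PiLp.zero_apply, mul_zero, add_zero, neg_nonpos]
  exact Finset.sum_nonneg fun i _ => mul_nonneg hk0 (second_nonneg hv hm i)

lemma sq_contDiff (x0 : E2) (B : ℝ) : ContDiff ℝ 2 (fun y : E2 => ‖y - x0‖^2/2 + B) :=
  (((contDiff_id.sub contDiff_const).norm_sq ℝ).div_const 2).add contDiff_const

lemma sq_hasGrad (x0 : E2) (B : ℝ) (y : E2) :
    HasGradientAt (fun y : E2 => ‖y - x0‖^2/2 + B) (y - x0) y := by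
  rw [hasGradientAt_iff_hasFDerivAt]
  have h := ((((hasFDerivAt_id (𝕜 := ℝ) y).sub_const x0).norm_sq).mul_const (1/2)).add_const B
  refine (h.congr_of_eventuallyEq ?_).congr_fderiv ?_
  · exact Eventually.of_forall fun y => by simp [div_eq_mul_inv]
  · ext z; simp

lemma sq_ellOp {k : E2 → ℝ} {x : E2} (x0 : E2) (B : ℝ) (hk : DifferentiableAt ℝ k x) :
    ellOp k (fun y : E2 => ‖y - x0‖^2/2 + B) x = -(2 * k x + fderiv ℝ k x (x - x0)) := by
  unfold ellOp
  rw [gradient_eq (sq_hasGrad x0 B), fderiv_fun_smul hk (by fun_prop)]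
  have : x - x0 = ∑ i : Fin 2, (x - x0) i • (EuclideanSpace.single i 1 : E2) := by
    ext j; fin_cases j <;> simp
  conv_rhs => rw [this]
  simp [fderiv_sub_const]
  ring

lemma exists_normal {Ω : Set E2} (hΩo : IsOpen Ω) (hΩconv : Convex ℝ Ω) (hne : Ω.Nonempty)
    {x : E2} (hx : x ∈ frontier Ω) (G : E2) (hG : ∀ y ∈ closure Ω, 0 ≤ (inner ℝ G (y - x) : ℝ)) :
    ∃ ν : E2, ‖ν‖ = 1 ∧ (∀ y ∈ closure Ω, (inner ℝ ν (y - x) : ℝ) ≤ 0) ∧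
      (inner ℝ G ν : ℝ) ≤ 0 := by
  -- a nonzero vector suffices
  suffices h : ∃ ν : E2, ν ≠ 0 ∧ (∀ y ∈ closure Ω, (inner ℝ ν (y - x) : ℝ) ≤ 0) ∧
      (inner ℝ G ν : ℝ) ≤ 0 by
    obtain ⟨ν, h0, h1, h2⟩ := h
    refine ⟨‖ν‖⁻¹ • ν, ?_, ?_, ?_⟩
    · rw [norm_smul]; simp [h0]
    · intro y hy
      rw [real_inner_smul_left]
      exact mul_nonpos_of_nonneg_of_nonpos (by positivity) (h1 y hy)
    · rw [real_inner_smul_right]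
      exact mul_nonpos_of_nonneg_of_nonpos (by positivity) h2
  by_cases h0 : G = 0
  · have hx' : x ∉ Ω := by
      rw [hΩo.frontier_eq] at hx; exact hx.2
    obtain ⟨φ, hφ⟩ := geometric_hahn_banach_open_point hΩconv hΩo hx'
    refine ⟨(InnerProductSpace.toDual ℝ E2).symm φ, ?_, ?_, by simp [h0]⟩
    · intro h
      have : φ = 0 := by simpa using h
      obtain ⟨a, ha⟩ := hne
      have := hφ a ha
      simp_all
    · intro y hy
      rw [InnerProductSpace.toDual_symm_apply, map_sub, sub_nonpos]
      exact closure_minimal (t := {y | φ y ≤ φ x}) (fun a ha => (hφ a ha).le)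
        (isClosed_le φ.continuous continuous_const) hy
  · refine ⟨-G, by simpa using h0, ?_, ?_⟩
    · intro y hy; rw [inner_neg_left]; linarith [hG y hy]
    · rw [inner_neg_right]; simp

lemma slice_x {z : E2 → ℝ → ℝ} (hz : ContDiff ℝ (⊤ : ℕ∞) (Function.uncurry z)) (t : ℝ) :
    ContDiff ℝ 2 (fun y => z y t) := by
  have h : ContDiff ℝ 2 (Function.uncurry z) := hz.of_le (WithTop.coe_le_coe.2 (le_top : (2 : ℕ∞) ≤ ⊤))
  exact h.comp (contDiff_id.prodMk contDiff_const)

lemma slice_t {z : E2 → ℝ → ℝ} (hz : ContDiff ℝ (⊤ : ℕ∞) (Function.uncurry z)) (x : E2) :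
    Differentiable ℝ (z x) := by
  have h : ContDiff ℝ 2 (Function.uncurry z) := hz.of_le (WithTop.coe_le_coe.2 (le_top : (2 : ℕ∞) ≤ ⊤))
  exact (h.comp (contDiff_const.prodMk contDiff_id)).differentiable (by norm_num)

lemma k_diff {Ω : Set E2} (hΩo : IsOpen Ω) {k : E2 → ℝ} (hkC1 : ContDiffOn ℝ 1 k (closure Ω))
    {x : E2} (hx : x ∈ Ω) : DifferentiableAt ℝ k x :=
  (hkC1.differentiableOn (by norm_num)).differentiableAt
    (mem_of_superset (hΩo.mem_nhds hx) subset_closure)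

lemma sq_ellOp_bdd (Ω : Set E2) (hΩo : IsOpen Ω) (hΩb : Bornology.IsBounded Ω)
    (hΩconv : Convex ℝ Ω) (k : E2 → ℝ) (hkC1 : ContDiffOn ℝ 1 k (closure Ω)) (x0 : E2) :
    ∃ C : ℝ, 0 < C ∧ ∀ x ∈ Ω, 2 * k x + fderiv ℝ k x (x - x0) < C := by
  rcases Ω.eq_empty_or_nonempty with rfl | hne
  · exact ⟨1, one_pos, by simp⟩
  have hcomp : IsCompact (closure Ω) := hΩb.isCompact_closure
  have huniq : UniqueDiffOn ℝ (closure Ω) :=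
    uniqueDiffOn_convex hΩconv.closure
      (hne.mono (interior_maximal subset_closure hΩo))
  have hcont : ContinuousOn (fun x => 2 * k x + fderivWithin ℝ k (closure Ω) x (x - x0))
      (closure Ω) := by
    refine (continuousOn_const.mul hkC1.continuousOn).add ?_
    exact (hkC1.continuousOn_fderivWithin huniq (by norm_num)).clm_apply (by fun_prop)
  obtain ⟨M, hM⟩ := hcomp.bddAbove_image hcont
  refine ⟨max M 0 + 1, by positivity, fun x hx => ?_⟩
  have := hM ⟨x, subset_closure hx, rfl⟩
  simp only at this
  rw [fderivWithin_of_mem_nhds (mem_of_superset (hΩo.mem_nhds hx) subset_closure)] at this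
  linarith [le_max_left M 0]

lemma deriv_nonpos_left {g : ℝ → ℝ} {t : ℝ} (ht : 0 < t) (hg : DifferentiableAt ℝ g t)
    (hmin : ∀ s ∈ Icc 0 t, g t ≤ g s) : deriv g t ≤ 0 := by
  have h := hg.hasDerivAt.hasDerivWithinAt (s := Iio t)
  rw [hasDerivWithinAt_iff_tendsto_slope] at h
  have h2 : Iio t \ {t} = Iio t := by simp
  rw [h2] at h
  refine le_of_tendsto h ?_
  filter_upwards [Ioo_mem_nhdsLT ht] with s hs
  rw [slope_def_field]
  exact div_nonpos_of_nonneg_of_nonpos (by linarith [hmin s ⟨hs.1.le, hs.2.le⟩]) (by linarith [hs.2])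

theorem comparison
    (Ω : Set E2) (hΩo : IsOpen Ω) (hΩb : Bornology.IsBounded Ω) (hΩconv : Convex ℝ Ω)
    (S : ℝ) (k μ : E2 → ℝ) (hk : ∀ x ∈ closure Ω, 0 < k x)
    (hkC1 : ContDiffOn ℝ 1 k (closure Ω))
    (hμ : ∀ x ∈ frontier Ω, 0 ≤ μ x)
    (c : E2 → ℝ) (hc : ∀ x ∈ Ω, 0 ≤ c x)
    (z : E2 → ℝ → ℝ) (hz : ContDiff ℝ (⊤ : ℕ∞) (Function.uncurry z))
    (pde : ∀ x ∈ Ω, ∀ t : ℝ, 0 < t → t ≤ S →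
      0 ≤ deriv (z x) t + ellOp k (fun y => z y t) x + c x * z x t)
    (ic : ∀ x ∈ Ω, 0 ≤ z x 0)
    (robin : ∀ x ∈ frontier Ω, ∀ ν : E2, ‖ν‖ = 1 →
      (∀ y ∈ closure Ω, (inner ℝ ν (y - x) : ℝ) ≤ 0) →
      ∀ t : ℝ, 0 < t → t ≤ S →
        k x * fderiv ℝ (fun y => z y t) x ν + μ x * z x t = 0) :
    ∀ x ∈ Ω, ∀ t : ℝ, 0 ≤ t → t ≤ S → 0 ≤ z x t := by
  intro x1 hx1 t1 ht1 ht1S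
  set x0 := x1
  have hx0 : x0 ∈ Ω := hx1
  obtain ⟨C, hC0, hC⟩ := sq_ellOp_bdd Ω hΩo hΩb hΩconv k hkC1 x0
  have key : ∀ ε > 0, 0 ≤ z x1 t1 + ε * (‖x1 - x0‖^2/2 + C * t1) := by
    intro ε hε
    have hcomp : IsCompact (closure Ω ×ˢ Icc 0 S) := hΩb.isCompact_closure.prod isCompact_Icc
    have hcont : Continuous (fun p : E2 × ℝ => z p.1 p.2 + ε * (‖p.1 - x0‖^2/2 + C * p.2)) := by
      have : Continuous (fun p : E2 × ℝ => z p.1 p.2) := hz.continuous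
      fun_prop
    have hmem1 : (x1, t1) ∈ closure Ω ×ˢ Icc 0 S := ⟨subset_closure hx1, ht1, ht1S⟩
    obtain ⟨⟨x, t⟩, ⟨hx, ht⟩, hmin⟩ := hcomp.exists_isMinOn ⟨_, hmem1⟩ hcont.continuousOn
    have hmin' : ∀ y ∈ closure Ω, ∀ s ∈ Icc 0 S,
        z x t + ε * (‖x - x0‖^2/2 + C * t) ≤ z y s + ε * (‖y - x0‖^2/2 + C * s) :=
      fun y hy s hs => hmin (show (y, s) ∈ _ from ⟨hy, hs⟩)
    refine le_trans ?_ (hmin' x1 hmem1.1 t1 hmem1.2)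
    by_contra hneg
    push Not at hneg
    simp only at hx ht
    have hpos : 0 ≤ ‖x - x0‖^2/2 + C * t := by have := ht.1; positivity
    have hzneg : z x t < 0 := by nlinarith [mul_nonneg hε.le hpos]
    have htpos : 0 < t := by
      rcases ht.1.eq_or_lt with h | h
      · exfalso
        have : 0 ≤ z x 0 := closure_minimal (t := {y | 0 ≤ z y 0}) ic
          (isClosed_le continuous_const (slice_x hz 0).continuous) hx
        rw [← h] at hzneg; linarith
      · exact h
    have hsx := slice_x hz t
    have hsq := sq_contDiff x0 (C * t)
    by_cases hxΩ : x ∈ Ω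
    · have hkd := k_diff hΩo hkC1 hxΩ
      have hlm : IsLocalMin (fun y => z y t + ε * (‖y - x0‖^2/2 + C * t)) x := by
        filter_upwards [hΩo.mem_nhds hxΩ] with y hy
        exact hmin' y (subset_closure hy) t ht
      have hell := ellOp_min hkd (hk x hx).le (hsx.add (contDiff_const.mul hsq)) hlm
      rw [ellOp_comb ε hkd hsx hsq, sq_ellOp x0 (C * t) hkd] at hell
      have hdt : HasDerivAt (fun s => z x s + ε * (‖x - x0‖^2/2 + C * s))
          (deriv (z x) t + ε * (C * 1)) t :=
        (slice_t hz x t).hasDerivAt.add ((((hasDerivAt_id t).const_mul C).const_add _).const_mul ε)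
      have hd := deriv_nonpos_left htpos hdt.differentiableAt
        (fun s hs => hmin' x hx s ⟨hs.1, hs.2.trans ht.2⟩)
      rw [hdt.deriv] at hd
      have hp := pde x hxΩ t htpos ht.2
      have h1 : c x * z x t ≤ 0 := mul_nonpos_of_nonneg_of_nonpos (hc x hxΩ) hzneg.le
      have h2 := mul_lt_mul_of_pos_left (hC x hxΩ) hε
      linarith
    · have hxf : x ∈ frontier Ω := by rw [hΩo.frontier_eq]; exact ⟨hx, hxΩ⟩
      have hdx : HasFDerivAt (fun y => z y t + ε * (‖y - x0‖^2/2 + C * t))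
          (fderiv ℝ (fun y => z y t) x + ε • (InnerProductSpace.toDual ℝ E2 (x - x0))) x :=
        (hsx.differentiable (by norm_num) x).hasFDerivAt.add
          ((hasGradientAt_iff_hasFDerivAt.1 (sq_hasGrad x0 (C * t) x)).const_mul ε)
      set L := fderiv ℝ (fun y => z y t) x + ε • (InnerProductSpace.toDual ℝ E2 (x - x0)) with hL
      have hmo : IsLocalMinOn (fun y => z y t + ε * (‖y - x0‖^2/2 + C * t)) (closure Ω) x := by
        filter_upwards [self_mem_nhdsWithin] with y hy
        exact hmin' y hy t ht
      have hG : ∀ y ∈ closure Ω,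
          0 ≤ (inner ℝ ((InnerProductSpace.toDual ℝ E2).symm L) (y - x) : ℝ) := by
        intro y hy
        rw [InnerProductSpace.toDual_symm_apply]
        exact hmo.hasFDerivWithinAt_nonneg hdx.hasFDerivWithinAt
          (sub_mem_posTangentConeAt_of_segment_subset (hΩconv.closure.segment_subset hx hy))
      obtain ⟨ν, hν1, hν2, hν3⟩ := exists_normal hΩo hΩconv ⟨x0, hx0⟩ hxf _ hG
      rw [InnerProductSpace.toDual_symm_apply] at hν3
      have hr := robin x hxf ν hν1 hν2 t htpos ht.2
      have hLν : L ν = fderiv ℝ (fun y => z y t) x ν + ε * inner ℝ (x - x0) ν := by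
        simp [hL, inner_sub_left]
      have hin : 0 < (inner ℝ (x - x0) ν : ℝ) := by
        obtain ⟨r, hr0, hball⟩ := Metric.isOpen_iff.1 hΩo x0 hx0
        have hmem : x0 + (r/2) • ν ∈ Ω := hball (by
          rw [Metric.mem_ball, dist_eq_norm]
          simp [norm_smul, hν1, abs_of_pos hr0]; linarith)
        have h := hν2 _ (subset_closure hmem)
        have e : x0 + (r/2) • ν - x = (r/2) • ν - (x - x0) := by abel
        rw [e, inner_sub_right, real_inner_smul_right, real_inner_self_eq_norm_sq, hν1,
          real_inner_comm] at h
        linarith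
      have h1 : μ x * z x t ≤ 0 := mul_nonpos_of_nonneg_of_nonpos (hμ x hxf) hzneg.le
      have h2 : fderiv ℝ (fun y => z y t) x ν < 0 := by
        rw [hLν] at hν3; linarith [mul_pos hε hin]
      have h3 := mul_neg_of_pos_of_neg (hk x hx) h2
      linarith
  have hlim : Tendsto (fun ε : ℝ => z x1 t1 + ε * (‖x1 - x0‖^2/2 + C * t1)) (𝓝[>] 0)
      (𝓝 (z x1 t1 + 0 * (‖x1 - x0‖^2/2 + C * t1))) := by
    apply Tendsto.mono_left _ nhdsWithin_le_nhds
    exact Continuous.tendsto (by fun_prop) 0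
  have := ge_of_tendsto hlim (eventually_nhdsWithin_of_forall key)
  simpa using this

/-- the initial approximation (16) satisfies `c⁰ ≥ c` on `Ω`,
and the corresponding solution satisfies `u⁰ ≤ u` on `Ω × (0,T]`. -/
theorem initial_approximation_above
    (Ω : Set E2) (hΩo : IsOpen Ω) (hΩb : Bornology.IsBounded Ω) (hΩconv : Convex ℝ Ω)
    (T : ℝ) (hT : 0 < T)
    (k μ : E2 → ℝ) (k₁ k₂ : ℝ) (hk₁ : 0 < k₁)
    (hkbd : ∀ x ∈ closure Ω, k₁ ≤ k x ∧ k x ≤ k₂)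
    (hkC1 : ContDiffOn ℝ 1 k (closure Ω))
    (hμ : ∀ x ∈ frontier Ω, 0 ≤ μ x)
    (f : E2 → ℝ → ℝ) (hf : ContDiff ℝ (⊤ : ℕ∞) (Function.uncurry f))
    (c : E2 → ℝ) (hc : ∀ x ∈ Ω, 0 ≤ c x)
    (u : E2 → ℝ → ℝ) (hureg : ContDiff ℝ (⊤ : ℕ∞) (Function.uncurry u))
    (hu : IsDirectSolution Ω T k μ c f u)
    (hf0 : ∀ x ∈ Ω, f x 0 = 0)
    (hft : ∀ x ∈ Ω, ∀ t : ℝ, 0 ≤ t → t ≤ T → 0 < deriv (f x) t)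
    (ψ : E2 → ℝ) (hψdef : ∀ x, ψ x = u x T) (hψpos : ∀ x ∈ Ω, 0 < ψ x)
    (c0 : E2 → ℝ) (hc0 : ∀ x ∈ Ω, c0 x * ψ x = - ellOp k ψ x + f x T)
    (u0 : E2 → ℝ → ℝ) (hu0reg : ContDiff ℝ (⊤ : ℕ∞) (Function.uncurry u0))
    (hu0 : IsDirectSolution Ω T k μ c0 f u0) :
    (∀ x ∈ Ω, c x ≤ c0 x) ∧
      (∀ x ∈ Ω, ∀ t : ℝ, 0 < t → t ≤ T → u0 x t ≤ u x t) := by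
  classical
  have hkpos : ∀ x ∈ closure Ω, 0 < k x := fun x hx => hk₁.trans_le (hkbd x hx).1
  have hfd : ∀ x, Differentiable ℝ (f x) := slice_t hf
  have hfmono : ∀ x ∈ Ω, MonotoneOn (f x) (Icc 0 T) := by
    intro x hx
    refine monotoneOn_of_deriv_nonneg (convex_Icc 0 T) (hfd x).continuous.continuousOn
      (hfd x).differentiableOn ?_
    intro t ht
    rw [interior_Icc] at ht
    exact (hft x hx t ht.1.le ht.2.le).le
  have hunonneg : ∀ x ∈ Ω, ∀ t : ℝ, 0 ≤ t → t ≤ T → 0 ≤ u x t := by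
    refine comparison Ω hΩo hΩb hΩconv T k μ hkpos hkC1 hμ c hc u hureg ?_
      (fun x hx => (hu.ic x hx).ge) hu.robin
    intro x hx t ht htT
    rw [hu.pde x hx t ht htT, ← hf0 x hx]
    exact hfmono x hx ⟨le_rfl, hT.le⟩ ⟨ht.le, htT⟩ ht.le
  have humono : ∀ x ∈ Ω, ∀ h : ℝ, 0 < h → ∀ t, 0 ≤ t → t ≤ T - h → 0 ≤ u x (t + h) - u x t := by
    intro x hx h hh t ht0 htT
    refine comparison Ω hΩo hΩb hΩconv (T - h) k μ hkpos hkC1 hμ c hc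
      (fun x t => u x (t + h) - u x t) ?_ ?_ ?_ ?_ x hx t ht0 htT
    · have : ContDiff ℝ (⊤ : ℕ∞) (fun p : E2 × ℝ => (p.1, p.2 + h)) := by fun_prop
      exact (hureg.comp this).sub hureg
    · intro x hx t ht htT
      have e1 : deriv (fun t => u x (t + h) - u x t) t = deriv (u x) (t + h) - deriv (u x) t := by
        have h1 : DifferentiableAt ℝ (fun t => u x (t + h)) t :=
          (slice_t hureg x).comp (by fun_prop : Differentiable ℝ (fun t : ℝ => t + h)) t
        rw [deriv_fun_sub h1 (slice_t hureg x t), deriv_comp_add_const]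
      have e2 : ellOp k (fun y => u y (t + h) - u y t) x
          = ellOp k (fun y => u y (t + h)) x - ellOp k (fun y => u y t) x := by
        have := ellOp_comb (-1) (k_diff hΩo hkC1 hx) (slice_x hureg (t + h)) (slice_x hureg t)
        simpa [sub_eq_add_neg] using this
      have p1 := hu.pde x hx (t + h) (by linarith) (by linarith)
      have p2 := hu.pde x hx t ht (by linarith)
      have p3 := hfmono x hx (a := t) (b := t + h) ⟨ht.le, by linarith⟩
        ⟨by linarith, by linarith⟩ (by linarith)
      rw [e1, e2]
      linarith
    · intro x hx
      simp only [zero_add, hu.ic x hx, sub_zero]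
      exact hunonneg x hx h hh.le (by linarith)
    · intro x hx ν h1 h2 t ht htT
      have r1 := hu.robin x hx ν h1 h2 (t + h) (by linarith) (by linarith)
      have r2 := hu.robin x hx ν h1 h2 t ht (by linarith)
      rw [fderiv_fun_sub ((slice_x hureg (t + h)).differentiable (by norm_num) x)
        ((slice_x hureg t).differentiable (by norm_num) x)]
      simp only [sub_apply]
      linarith
  have hut : ∀ x ∈ Ω, 0 ≤ deriv (u x) T := by
    intro x hx
    have hd : HasDerivAt (fun t => - u x t) (- deriv (u x) T) T :=
      (slice_t hureg x T).hasDerivAt.neg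
    have := deriv_nonpos_left hT hd.differentiableAt (by
      intro s hs
      rcases hs.2.eq_or_lt with h | h
      · rw [h]
      · have := humono x hx (T - s) (by linarith) s hs.1 (by linarith)
        rw [add_sub_cancel] at this
        linarith)
    rw [hd.deriv] at this
    linarith
  have hcc : ∀ x ∈ Ω, c x ≤ c0 x := by
    intro x hx
    have p := hu.pde x hx T hT le_rfl
    have q := hc0 x hx
    have e : ψ = fun y => u y T := funext hψdef
    have hp := hψpos x hx
    have h1 : c x * ψ x ≤ c0 x * ψ x := by
      rw [q, e]; linarith [hut x hx]
    exact le_of_mul_le_mul_right h1 hp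
  refine ⟨hcc, ?_⟩
  intro x hx t ht htT
  rw [← sub_nonneg]
  refine comparison Ω hΩo hΩb hΩconv T k μ hkpos hkC1 hμ c0
    (fun x hx => (hc x hx).trans (hcc x hx))
    (fun x t => u x t - u0 x t) (hureg.sub hu0reg) ?_ ?_ ?_ x hx t ht.le htT
  · intro x hx t ht htT
    have e1 : deriv (fun t => u x t - u0 x t) t = deriv (u x) t - deriv (u0 x) t :=
      deriv_fun_sub (slice_t hureg x t) (slice_t hu0reg x t)
    have e2 : ellOp k (fun y => u y t - u0 y t) x
        = ellOp k (fun y => u y t) x - ellOp k (fun y => u0 y t) x := by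
      have := ellOp_comb (-1) (k_diff hΩo hkC1 hx) (slice_x hureg t) (slice_x hu0reg t)
      simpa [sub_eq_add_neg] using this
    have p1 := hu.pde x hx t ht htT
    have p2 := hu0.pde x hx t ht htT
    have p3 := mul_le_mul_of_nonneg_right (hcc x hx) (hunonneg x hx t ht.le htT)
    rw [e1, e2]
    linarith
  · intro x hx
    simp [hu.ic x hx, hu0.ic x hx]
  · intro x hx ν h1 h2 t ht htT
    have r1 := hu.robin x hx ν h1 h2 t ht htT
    have r2 := hu0.robin x hx ν h1 h2 t ht htT
    rw [fderiv_fun_sub ((slice_x hureg t).differentiable (by norm_num) x)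
      ((slice_x hu0reg t).differentiable (by norm_num) x)]
    simp only [sub_apply]
    linarith

end
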